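/- There exist constants Θ ≥ 1 and c > 0 such that for all κ, T₁, T₂ > 0 with κ²T₁ ≥ Θ and T₂ ≥ T₁, and all measurable ρ : [0,1] → [0,∞) with ∫₀¹ ρ = 1 and measurable T : [0,1] → (0,∞) with T₁ ≤ T(y) ≤ T₂ for all y, one has (1 − c (κ²T₁)^{−1/4}) √(2/π) √(T₁T₂)/(√T₁ + √T₂) ≤ (C₋ + C₂C₊)/(1 − C₁C₂) ≤ (1 + c (κ²T₁)^{−1/4}) √(2/π) √(T₁T₂)/(√T₁ + √T₂). -/

import Mathlib

open MeasureTheory Real Set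

/-- Centered Maxwellian with temperature `T`: `M_T(v) = (2πT)^{-1/2} exp(−v²/(2T))`. -/
noncomputable def Mxw (T v : ℝ) : ℝ :=
  (Real.sqrt (2 * π * T))⁻¹ * Real.exp (-v ^ 2 / (2 * T))

/-- Wall Maxwellian with temperature `T`: `M̃_T(v) = (1/T) exp(−v²/(2T))`,
normalized so that `∫₀^∞ v M̃_T(v) dv = 1`. -/
noncomputable def wallMxw (T v : ℝ) : ℝ :=
  T⁻¹ * Real.exp (-v ^ 2 / (2 * T))

/-- `C_i = ∫₀^∞ v e^{−1/(κv)} M̃_{T_i}(v) dv`. -/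
noncomputable def Cwall (κ T : ℝ) : ℝ :=
  ∫ v in Ioi (0 : ℝ), v * Real.exp (-1 / (κ * v)) * wallMxw T v

/-- `C₋ = (1/κ) ∫₀¹ ρ(y) (∫₀^∞ e^{−y/(κv)} M_{T(y)}(v) dv) dy`. -/
noncomputable def Cminus (κ : ℝ) (ρ T : ℝ → ℝ) : ℝ :=
  κ⁻¹ * ∫ y in Icc (0 : ℝ) 1, ρ y * ∫ v in Ioi (0 : ℝ), Real.exp (-y / (κ * v)) * Mxw (T y) v

/-- `C₊ = (1/κ) ∫₀¹ ρ(y) (∫₀^∞ e^{−(1−y)/(κv)} M_{T(y)}(v) dv) dy`. -/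
noncomputable def Cplus (κ : ℝ) (ρ T : ℝ → ℝ) : ℝ :=
  κ⁻¹ * ∫ y in Icc (0 : ℝ) 1, ρ y * ∫ v in Ioi (0 : ℝ), Real.exp (-(1 - y) / (κ * v)) * Mxw (T y) v

/-- `f` is a mild steady state of the linear BGK equation with data `(κ, T₁, T₂, ρ, T)`. -/
def IsMildSteadyState (κ T₁ T₂ : ℝ) (ρ T : ℝ → ℝ) (f : ℝ → ℝ → ℝ) : Prop :=
  Cwall κ T₁ * Cwall κ T₂ < 1 ∧
  IntegrableOn
    (fun y => ρ y * ∫ v in Ioi (0 : ℝ), Real.exp (-y / (κ * v)) * Mxw (T y) v)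
    (Icc (0 : ℝ) 1) ∧
  IntegrableOn
    (fun y => ρ y * ∫ v in Ioi (0 : ℝ), Real.exp (-(1 - y) / (κ * v)) * Mxw (T y) v)
    (Icc (0 : ℝ) 1) ∧
  (∀ x ∈ Icc (0 : ℝ) 1, ρ x = ∫ v, f x v) ∧
  (∀ x ∈ Icc (0 : ℝ) 1,
    (∀ᵐ v ∂(volume.restrict (Ioi (0 : ℝ))),
      f x v = Real.exp (-x / (κ * v)) * wallMxw T₁ v *
          ((Cminus κ ρ T + Cwall κ T₂ * Cplus κ ρ T) / (1 - Cwall κ T₁ * Cwall κ T₂)) +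
        ∫ y in (0 : ℝ)..x, (κ * v)⁻¹ * Real.exp (-(x - y) / (κ * v)) * ρ y * Mxw (T y) v) ∧
    (∀ᵐ v ∂(volume.restrict (Iio (0 : ℝ))),
      f x v = Real.exp (-(1 - x) / (κ * |v|)) * wallMxw T₂ v *
          ((Cplus κ ρ T + Cwall κ T₁ * Cminus κ ρ T) / (1 - Cwall κ T₁ * Cwall κ T₂)) +
        ∫ y in x..1, (κ * |v|)⁻¹ * Real.exp (-(y - x) / (κ * |v|)) * ρ y * Mxw (T y) v))

/-- The half-line average of the attenuation factor `e^{−y/(κv)}` against `M_T`. -/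
noncomputable def transmission (κ T y : ℝ) : ℝ :=
  ∫ v in Ioi (0 : ℝ), Real.exp (-y / (κ * v)) * Mxw T v

lemma Mxw_nonneg (T v : ℝ) : 0 ≤ Mxw T v := by unfold Mxw; positivity

lemma wallMxw_nonneg {T : ℝ} (hT : 0 < T) (v : ℝ) : 0 ≤ wallMxw T v := by
  unfold wallMxw; positivity

lemma Mxw_le {T : ℝ} (hT : 0 < T) (v : ℝ) : Mxw T v ≤ (√(2 * π * T))⁻¹ := by
  unfold Mxw
  refine mul_le_of_le_one_right (by positivity) (exp_le_one_iff.2 ?_)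
  rw [neg_div]
  exact neg_nonpos.2 (by positivity)

lemma neg_sq_div_two_mul (T v : ℝ) : -v ^ 2 / (2 * T) = -(2 * T)⁻¹ * v ^ 2 := by ring

lemma integrable_Mxw {T : ℝ} (hT : 0 < T) : Integrable (Mxw T) := by
  unfold Mxw
  simp_rw [neg_sq_div_two_mul]
  exact (integrable_exp_neg_mul_sq (by positivity)).const_mul _

lemma integral_Mxw {T : ℝ} (hT : 0 < T) : ∫ v in Ioi (0 : ℝ), Mxw T v = 1 / 2 := by
  unfold Mxw
  simp_rw [neg_sq_div_two_mul]
  rw [integral_const_mul, integral_gaussian_Ioi]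
  have h : π / (2 * T)⁻¹ = 2 * π * T := by field_simp
  have : 0 < √(2 * π * T) := by positivity
  rw [h]
  field_simp

lemma wallMxw_eq {T : ℝ} (hT : 0 < T) (v : ℝ) :
    wallMxw T v = √(2 * π * T) / T * Mxw T v := by
  have : 0 < √(2 * π * T) := by positivity
  unfold wallMxw Mxw
  field_simp

lemma integrable_mul_wallMxw {T : ℝ} (hT : 0 < T) :
    Integrable fun v => v * wallMxw T v := by
  unfold wallMxw
  simp_rw [neg_sq_div_two_mul, mul_left_comm _ T⁻¹]
  exact (integrable_mul_exp_neg_mul_sq (by positivity)).const_mul _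

lemma integral_mul_wallMxw {T : ℝ} (hT : 0 < T) :
    ∫ v in Ioi (0 : ℝ), v * wallMxw T v = 1 := by
  have h := integral_rpow_mul_exp_neg_mul_rpow (p := 2) (q := 1) (b := (2 * T)⁻¹)
    (by norm_num) (by norm_num) (by positivity)
  norm_num [rpow_neg_one] at h
  unfold wallMxw
  simp_rw [neg_sq_div_two_mul, mul_left_comm _ T⁻¹]
  rw [integral_const_mul]
  norm_num
  rw [h]
  field_simp

lemma attenuation_le_one {κ y v : ℝ} (hκ : 0 < κ) (hy : 0 ≤ y) (hv : 0 < v) :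
    Real.exp (-y / (κ * v)) ≤ 1 := by
  rw [exp_le_one_iff, neg_div]
  exact neg_nonpos.2 (by positivity)

lemma ae_norm_attenuation_le {κ y : ℝ} (hκ : 0 < κ) (hy : 0 ≤ y) :
    ∀ᵐ v ∂volume.restrict (Ioi (0 : ℝ)), ‖Real.exp (-y / (κ * v))‖ ≤ 1 := by
  filter_upwards [ae_restrict_mem measurableSet_Ioi] with v hv
  rw [norm_of_nonneg (exp_pos _).le]
  exact attenuation_le_one hκ hy hv

lemma integrableOn_attenuation_mul {κ y : ℝ} (hκ : 0 < κ) (hy : 0 ≤ y) {g : ℝ → ℝ}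
    (hg : Integrable g) :
    IntegrableOn (fun v => Real.exp (-y / (κ * v)) * g v) (Ioi 0) :=
  hg.integrableOn.bdd_mul
    (Measurable.aestronglyMeasurable (by fun_prop)) (ae_norm_attenuation_le hκ hy)

lemma transmission_le {κ T y : ℝ} (hκ : 0 < κ) (hT : 0 < T) (hy : 0 ≤ y) :
    transmission κ T y ≤ 1 / 2 := by
  rw [← integral_Mxw hT]
  refine setIntegral_mono_on (integrableOn_attenuation_mul hκ hy (integrable_Mxw hT))
    (integrable_Mxw hT).integrableOn measurableSet_Ioi fun v hv => ?_
  exact mul_le_of_le_one_left (Mxw_nonneg T v) (attenuation_le_one hκ hy hv)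

/-- Slow particles, `v ≤ s`, carry mass at most `s / √(2πT)`; fast ones are barely attenuated. -/
lemma le_transmission {κ T y δ s : ℝ} (hκ : 0 < κ) (hT : 0 < T) (hy : 0 ≤ y) (hy1 : y ≤ 1)
    (hδ : 0 ≤ δ) (hs : 0 < s) (hsδ : 1 ≤ κ * s * δ) :
    1 / 2 - δ / 2 - s * (√(2 * π * T))⁻¹ ≤ transmission κ T y := by
  have hM := (integrable_Mxw hT).integrableOn (s := Ioi 0)
  have hI : Integrable ((Ioc 0 s).indicator fun _ => (√(2 * π * T))⁻¹)
      (volume.restrict (Ioi (0 : ℝ))) := by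
    rw [integrable_indicator_iff measurableSet_Ioc]
    refine integrableOn_const ?_
    exact ((Measure.restrict_apply_le _ _).trans_lt measure_Ioc_lt_top).ne
  have hval : ∫ v in Ioi (0 : ℝ), (1 - δ) * Mxw T v
      - (Ioc 0 s).indicator (fun _ => (√(2 * π * T))⁻¹) v
      = 1 / 2 - δ / 2 - s * (√(2 * π * T))⁻¹ := by
    rw [integral_sub (hM.const_mul _) hI, integral_const_mul, integral_Mxw hT,
      integral_indicator_const _ measurableSet_Ioc, measureReal_restrict_apply measurableSet_Ioc,
      inter_eq_left.2 (fun v hv => hv.1), Real.volume_real_Ioc_of_le hs.le, smul_eq_mul]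
    ring
  rw [← hval]
  refine setIntegral_mono_on ((hM.const_mul _).sub hI)
    (integrableOn_attenuation_mul hκ hy (integrable_Mxw hT)) measurableSet_Ioi fun v hv => ?_
  have hv : 0 < v := hv
  have hM0 := Mxw_nonneg T v
  by_cases hvs : v ≤ s
  · rw [indicator_of_mem (show v ∈ Ioc 0 s from ⟨hv, hvs⟩)]
    have h1 := Mxw_le hT v
    have h2 : 0 ≤ Real.exp (-y / (κ * v)) * Mxw T v := by positivity
    nlinarith [mul_nonneg hδ hM0]
  · rw [indicator_of_notMem (fun h => hvs h.2), sub_zero]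
    refine mul_le_mul_of_nonneg_right ?_ hM0
    have h1 := one_sub_le_exp_neg (y / (κ * v))
    have h2 : y / (κ * v) ≤ δ := by
      rw [div_le_iff₀ (by positivity)]
      have : κ * s * δ ≤ κ * v * δ := by gcongr; exact (not_le.1 hvs).le
      linarith
    rw [neg_div]
    linarith

lemma one_sub_Cwall_eq {κ T : ℝ} (hκ : 0 < κ) (hT : 0 < T) :
    1 - Cwall κ T = ∫ v in Ioi (0 : ℝ), v * wallMxw T v
      - Real.exp (-1 / (κ * v)) * (v * wallMxw T v) := by
  rw [integral_sub (integrable_mul_wallMxw hT).integrableOn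
    (integrableOn_attenuation_mul hκ zero_le_one (integrable_mul_wallMxw hT)),
    integral_mul_wallMxw hT]
  unfold Cwall
  congr 2
  ext v
  ring

lemma one_sub_Cwall_le {κ T : ℝ} (hκ : 0 < κ) (hT : 0 < T) :
    1 - Cwall κ T ≤ κ⁻¹ * (√(2 * π * T) / T) * (1 / 2) := by
  rw [one_sub_Cwall_eq hκ hT, ← integral_Mxw hT, ← integral_const_mul]
  have hW := integrable_mul_wallMxw hT
  refine setIntegral_mono_on
    (hW.integrableOn.sub (integrableOn_attenuation_mul hκ zero_le_one hW))
    ((integrable_Mxw hT).integrableOn.const_mul _) measurableSet_Ioi fun v hv => ?_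
  have hv : 0 < v := hv
  have h := one_sub_le_exp_neg (1 / (κ * v))
  rw [mul_assoc, ← wallMxw_eq hT, neg_div]
  calc v * wallMxw T v - Real.exp (-(1 / (κ * v))) * (v * wallMxw T v)
      = v * (1 - Real.exp (-(1 / (κ * v)))) * wallMxw T v := by ring
    _ ≤ v * (1 / (κ * v)) * wallMxw T v :=
      mul_le_mul_of_nonneg_right (mul_le_mul_of_nonneg_left (by linarith) hv.le)
        (wallMxw_nonneg hT v)
    _ = κ⁻¹ * wallMxw T v := by field_simp

lemma le_one_sub_Cwall {κ T : ℝ} (hκ : 0 < κ) (hT : 0 < T) :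
    κ⁻¹ * (√(2 * π * T) / T) * transmission κ T 1 ≤ 1 - Cwall κ T := by
  rw [one_sub_Cwall_eq hκ hT, transmission, ← integral_const_mul]
  have hW := integrable_mul_wallMxw hT
  refine setIntegral_mono_on
    ((integrableOn_attenuation_mul hκ zero_le_one (integrable_Mxw hT)).const_mul _)
    (hW.integrableOn.sub (integrableOn_attenuation_mul hκ zero_le_one hW))
    measurableSet_Ioi fun v hv => ?_
  have hv : 0 < v := hv
  have h : 1 / (κ * v) * Real.exp (-(1 / (κ * v))) ≤ 1 - Real.exp (-(1 / (κ * v))) := by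
    have h1 := add_one_le_exp (1 / (κ * v))
    have h2 : Real.exp (1 / (κ * v)) * Real.exp (-(1 / (κ * v))) = 1 := by
      rw [← Real.exp_add]; simp
    nlinarith [exp_pos (-(1 / (κ * v)))]
  rw [neg_div]
  calc κ⁻¹ * (√(2 * π * T) / T) * (Real.exp (-(1 / (κ * v))) * Mxw T v)
      = v * (1 / (κ * v) * Real.exp (-(1 / (κ * v)))) * wallMxw T v := by
        rw [wallMxw_eq hT]; field_simp
    _ ≤ v * (1 - Real.exp (-(1 / (κ * v)))) * wallMxw T v :=
      mul_le_mul_of_nonneg_right (mul_le_mul_of_nonneg_left h hv.le) (wallMxw_nonneg hT v)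
    _ = _ := by ring

/-- A density average of a function with values in `[a, b]` stays in `[a, b]`. -/
lemma integral_density_mul_mem_Icc {μ : Measure ℝ} {ρ g : ℝ → ℝ} {a b : ℝ}
    (hρ : ∀ y, 0 ≤ ρ y) (hρ1 : ∫ y, ρ y ∂μ = 1) (hg : AEStronglyMeasurable g μ)
    (hab : ∀ᵐ y ∂μ, g y ∈ Icc a b) :
    ∫ y, ρ y * g y ∂μ ∈ Icc a b := by
  have hi : Integrable ρ μ := not_imp_comm.1 integral_undef (by rw [hρ1]; norm_num)
  have hig : Integrable (fun y => ρ y * g y) μ := by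
    refine hi.mul_bdd (c := max |a| |b|) hg ?_
    filter_upwards [hab] with y hy
    exact abs_le_max_abs_abs hy.1 hy.2
  constructor
  · calc a = ∫ y, ρ y * a ∂μ := by rw [integral_mul_const, hρ1, one_mul]
      _ ≤ _ := by
        refine integral_mono_ae (hi.mul_const a) hig ?_
        filter_upwards [hab] with y hy
        exact mul_le_mul_of_nonneg_left hy.1 (hρ y)
  · calc _ ≤ ∫ y, ρ y * b ∂μ := by
          refine integral_mono_ae hig (hi.mul_const b) ?_
          filter_upwards [hab] with y hy
          exact mul_le_mul_of_nonneg_left hy.2 (hρ y)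
      _ = b := by rw [integral_mul_const, hρ1, one_mul]

lemma stronglyMeasurable_transmission {κ : ℝ} {T s : ℝ → ℝ} (hT : Measurable T) (hs : Measurable s) :
    StronglyMeasurable fun y => transmission κ (T y) (s y) := by
  unfold transmission Mxw
  refine StronglyMeasurable.integral_prod_right (Measurable.stronglyMeasurable ?_)
  unfold Function.uncurry
  fun_prop

lemma quotient_bounds {δ a b x y p q A B : ℝ} (hδ : 0 ≤ δ) (hδ1 : δ ≤ 1 / 8)
    (ha : 0 < a) (hb : 0 < b) (hxa : a * (1 - 2 * δ) ≤ x) (hxa' : x ≤ a)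
    (hyb : b * (1 - 2 * δ) ≤ y) (hyb' : y ≤ b) (ha2 : a ≤ 2 * δ ^ 2) (hb2 : b ≤ 2 * δ ^ 2)
    (hp : p ∈ Icc (1 / 2 - δ) (1 / 2)) (hq : q ∈ Icc (1 / 2 - δ) (1 / 2))
    (hA : A = 1 - x) (hB : B = 1 - y) :
    (1 - 8 * δ) * (a + b)⁻¹ ≤ (p + B * q) / (1 - A * B) ∧
      (p + B * q) / (1 - A * B) ≤ (1 + 8 * δ) * (a + b)⁻¹ := by
  subst hA hB
  obtain ⟨hp1, hp2⟩ := hp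
  obtain ⟨hq1, hq2⟩ := hq
  have hδ2 : δ ^ 2 ≤ δ / 8 := by nlinarith
  have hx : 0 ≤ x := le_trans (mul_nonneg ha.le (by linarith)) hxa
  have hy : 0 ≤ y := le_trans (mul_nonneg hb.le (by linarith)) hyb
  have hD1 : 1 - (1 - x) * (1 - y) ≤ a + b := by nlinarith [mul_nonneg hx hy]
  have hD2 : (a + b) * (1 - 4 * δ) ≤ 1 - (1 - x) * (1 - y) := by
    have h1 : x * y ≤ a * (δ / 4) :=
      mul_le_mul hxa' (by linarith) hy ha.le
    nlinarith [mul_nonneg hb.le hδ, mul_nonneg ha.le hδ]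
  have hD : 0 < 1 - (1 - x) * (1 - y) :=
    lt_of_lt_of_le (mul_pos (by linarith) (by linarith)) hD2
  have hyq : y * q ≤ δ / 4 * (1 / 2) :=
    mul_le_mul (by linarith) hq2 (by linarith) (by linarith)
  have hyq0 : 0 ≤ y * q := mul_nonneg hy (by linarith)
  have hN1 : 1 - 3 * δ ≤ p + (1 - y) * q := by nlinarith
  have hN2 : p + (1 - y) * q ≤ 1 := by nlinarith
  rw [← div_eq_mul_inv, ← div_eq_mul_inv]
  constructor
  · rw [div_le_div_iff₀ (by linarith) hD]
    have h1 : (1 - 8 * δ) * (1 - (1 - x) * (1 - y)) ≤ (1 - 8 * δ) * (a + b) :=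
      mul_le_mul_of_nonneg_left hD1 (by linarith)
    have h2 : (1 - 8 * δ) * (a + b) ≤ (p + (1 - y) * q) * (a + b) :=
      mul_le_mul_of_nonneg_right (by linarith) (by linarith)
    linarith
  · rw [div_le_div_iff₀ hD (by linarith)]
    have h1 : (1 + 8 * δ) * ((a + b) * (1 - 4 * δ)) ≤ (1 + 8 * δ) * (1 - (1 - x) * (1 - y)) :=
      mul_le_mul_of_nonneg_left hD2 (by linarith)
    have h2 : (p + (1 - y) * q) * (a + b) ≤ 1 * (a + b) :=
      mul_le_mul_of_nonneg_right hN2 (by linarith)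
    have h3 : 0 ≤ (a + b) * ((1 + 8 * δ) * (1 - 4 * δ) - 1) :=
      mul_nonneg (by linarith) (by nlinarith)
    linarith

lemma sqrt_two_pi_mul_div {T : ℝ} (hT : 0 < T) : √(2 * π * T) / T = √(2 * π) / √T := by
  rw [Real.sqrt_mul (by positivity)]
  nth_rw 2 [← Real.mul_self_sqrt hT.le]
  field_simp

lemma inv_add_inv_sqrt_eq {T₁ T₂ : ℝ} (h₁ : 0 < T₁) (h₂ : 0 < T₂) :
    (√(2 * π) / √T₁ * (1 / 2) + √(2 * π) / √T₂ * (1 / 2))⁻¹ =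
      √(2 / π) * (√(T₁ * T₂) / (√T₁ + √T₂)) := by
  have e : √(2 / π) * √(2 * π) = 2 := by
    rw [← Real.sqrt_mul (by positivity),
      show 2 / π * (2 * π) = 2 ^ 2 by field_simp, Real.sqrt_sq (by norm_num)]
  have : 0 < √T₁ := by positivity
  have : 0 < √T₂ := by positivity
  rw [Real.sqrt_mul h₁.le, inv_eq_iff_eq_inv]
  refine eq_inv_of_mul_eq_one_left ?_
  field_simp
  linear_combination (√T₁ + √T₂) * e

lemma half_sub_le_transmission {κ T₁ T y δ : ℝ} (hκ : 0 < κ) (h₁ : 0 < T₁) (hT : T₁ ≤ T)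
    (hy : y ∈ Icc (0 : ℝ) 1) (hδ : 0 < δ) (hδκ : κ * √T₁ * δ ^ 2 = 1) :
    1 / 2 - δ ≤ transmission κ T y := by
  have hT0 : 0 < T := h₁.trans_le hT
  have hs : 0 < √T₁ * δ := by positivity
  have h := le_transmission (s := √T₁ * δ) hκ hT0 hy.1 hy.2 hδ.le hs
    (by rw [← hδκ]; exact le_of_eq (by ring))
  have h4 : 2 * √T₁ ≤ √(2 * π * T) := by
    apply Real.le_sqrt_of_sq_le
    rw [mul_pow, Real.sq_sqrt h₁.le]
    nlinarith [pi_gt_three]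
  have h5 : √T₁ * δ * (√(2 * π * T))⁻¹ ≤ δ / 2 := by
    rw [← div_eq_mul_inv, div_le_iff₀ (by positivity)]
    nlinarith
  linarith

lemma wall_deficit_bounds {κ T₁ T δ : ℝ} (hκ : 0 < κ) (h₁ : 0 < T₁) (hT : T₁ ≤ T)
    (hδ : 0 < δ) (hδκ : κ * √T₁ * δ ^ 2 = 1) :
    (√(2 * π) / √T * (1 / 2)) * κ⁻¹ * (1 - 2 * δ) ≤ 1 - Cwall κ T ∧
      1 - Cwall κ T ≤ (√(2 * π) / √T * (1 / 2)) * κ⁻¹ ∧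
      (√(2 * π) / √T * (1 / 2)) * κ⁻¹ ≤ 2 * δ ^ 2 := by
  have hT0 : 0 < T := h₁.trans_le hT
  have hl := le_one_sub_Cwall hκ hT0
  have hu := one_sub_Cwall_le hκ hT0
  rw [sqrt_two_pi_mul_div hT0] at hl hu
  have hJ := half_sub_le_transmission hκ h₁ hT (right_mem_Icc.2 zero_le_one) hδ hδκ
  have hc : 0 ≤ κ⁻¹ * (√(2 * π) / √T) := by positivity
  refine ⟨by nlinarith, by linarith, ?_⟩
  have h4 : √(2 * π) ≤ 4 := by
    apply Real.sqrt_le_iff.2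
    constructor <;> nlinarith [pi_le_four]
  have h5 : √T₁ ≤ √T := Real.sqrt_le_sqrt hT
  have : 0 < √T₁ := by positivity
  calc √(2 * π) / √T * (1 / 2) * κ⁻¹ ≤ 4 / √T₁ * (1 / 2) * κ⁻¹ := by gcongr
    _ = 2 * δ ^ 2 := by
      field_simp
      linarith

/-- asymptotics of the boundary-moment quotient `(C₋ + C₂C₊)/(1 − C₁C₂)`. -/
theorem boundary_moment_quotient_asymptotics :
    ∃ Θ c : ℝ, 1 ≤ Θ ∧ 0 < c ∧
      ∀ κ T₁ T₂ : ℝ, 0 < κ → 0 < T₁ → 0 < T₂ → Θ ≤ κ ^ 2 * T₁ → T₁ ≤ T₂ →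
        ∀ ρ T : ℝ → ℝ, Measurable ρ → (∀ y, 0 ≤ ρ y) →
          (∫ y in Icc (0 : ℝ) 1, ρ y) = 1 →
          Measurable T → (∀ y, 0 < T y) →
          (∀ y ∈ Icc (0 : ℝ) 1, T₁ ≤ T y ∧ T y ≤ T₂) →
          (1 - c * (κ ^ 2 * T₁) ^ (-(1 : ℝ) / 4)) *
              (Real.sqrt (2 / π) * (Real.sqrt (T₁ * T₂) / (Real.sqrt T₁ + Real.sqrt T₂))) ≤
            (Cminus κ ρ T + Cwall κ T₂ * Cplus κ ρ T) / (1 - Cwall κ T₁ * Cwall κ T₂) ∧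
          (Cminus κ ρ T + Cwall κ T₂ * Cplus κ ρ T) / (1 - Cwall κ T₁ * Cwall κ T₂) ≤
            (1 + c * (κ ^ 2 * T₁) ^ (-(1 : ℝ) / 4)) *
              (Real.sqrt (2 / π) * (Real.sqrt (T₁ * T₂) / (Real.sqrt T₁ + Real.sqrt T₂))) := by
  refine ⟨8 ^ 4, 8, by norm_num, by norm_num, ?_⟩
  intro κ T₁ T₂ hκ h₁ h₂ hΘ h12 ρ T _ hρ hρ1 hTm _ hT
  have hX : 0 < κ ^ 2 * T₁ := by positivity
  set δ := (κ ^ 2 * T₁) ^ (-(1 : ℝ) / 4) with hδdef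
  have hδ : 0 < δ := by positivity
  have hδ8 : δ ≤ 1 / 8 := by
    calc δ ≤ ((8 : ℝ) ^ (4 : ℝ)) ^ (-(1 : ℝ) / 4) :=
          rpow_le_rpow_of_nonpos (by positivity) (by exact_mod_cast hΘ) (by norm_num)
      _ = 1 / 8 := by rw [← rpow_mul (by norm_num)]; norm_num [rpow_neg_one]
  have hδκ : κ * √T₁ * δ ^ 2 = 1 := by
    have e1 : κ * √T₁ = (κ ^ 2 * T₁) ^ (1 / 2 : ℝ) := by
      rw [← Real.sqrt_eq_rpow, Real.sqrt_mul (by positivity), Real.sqrt_sq hκ.le]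
    rw [e1, hδdef, ← rpow_natCast ((κ ^ 2 * T₁) ^ (-(1 : ℝ) / 4)) 2, ← rpow_mul hX.le, ← rpow_add hX]
    norm_num
  have hmem : ∀ s : ℝ → ℝ, Measurable s → (∀ y ∈ Icc (0 : ℝ) 1, s y ∈ Icc (0 : ℝ) 1) →
      ∫ y in Icc (0 : ℝ) 1, ρ y * transmission κ (T y) (s y) ∈ Icc (1 / 2 - δ) (1 / 2) := by
    intro s hs hs1
    refine integral_density_mul_mem_Icc hρ hρ1
      (stronglyMeasurable_transmission hTm hs).aestronglyMeasurable ?_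
    filter_upwards [ae_restrict_mem measurableSet_Icc] with y hy
    exact ⟨half_sub_le_transmission hκ h₁ (hT y hy).1 (hs1 y hy) hδ hδκ,
      transmission_le hκ (h₁.trans_le (hT y hy).1) (hs1 y hy).1⟩
  have hp := hmem (fun y => y) measurable_id fun y hy => hy
  have hq := hmem (fun y => 1 - y) (by fun_prop)
    fun y hy => ⟨by linarith [hy.2], by linarith [hy.1]⟩
  obtain ⟨hx, hx', ha⟩ := wall_deficit_bounds hκ h₁ le_rfl hδ hδκ
  obtain ⟨hy, hy', hb⟩ := wall_deficit_bounds hκ h₁ h12 hδ hδκ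
  have key := quotient_bounds hδ.le hδ8 (by positivity) (by positivity) hx hx' hy hy' ha hb hp hq
    (sub_sub_cancel _ _).symm (sub_sub_cancel _ _).symm
  rw [← add_mul, mul_inv, inv_inv, inv_add_inv_sqrt_eq h₁ h₂] at key
  have hquot : (Cminus κ ρ T + Cwall κ T₂ * Cplus κ ρ T) / (1 - Cwall κ T₁ * Cwall κ T₂) =
      κ⁻¹ * (((∫ y in Icc (0 : ℝ) 1, ρ y * transmission κ (T y) y) +
        Cwall κ T₂ * ∫ y in Icc (0 : ℝ) 1, ρ y * transmission κ (T y) (1 - y)) /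
          (1 - Cwall κ T₁ * Cwall κ T₂)) := by
    unfold Cminus Cplus transmission
    ring
  rw [hquot, inv_mul_eq_div, le_div_iff₀ hκ, div_le_iff₀ hκ, mul_assoc, mul_assoc (1 + 8 * δ)]
  exact key
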